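/- Let A be a unital associative ℂ-algebra and let L(u) = (L^a_b(u))_{a,b∈I} be a matrix-valued polynomial in u with entries in A satisfying the RLL relation for the fundamental R-matrix. Then the entries of C(u), namely C_{ab}(u) := Σ_{e,f∈I} ε^{ef} L_{ea}(u−β) L_{fb}(u), are central with respect to L: for all u,v ∈ ℂ and all a,b,c,d ∈ I, the commutator [C_{ab}(u), L_{cd}(v)] = 0. -/

import Mathlib

noncomputable section

/-- The index set `I = {-m,…,-1,(0),1,…,m}` (the value `0` is included iff `zero = true`). -/
def Idx (m : ℤ) (zero : Bool) : Finset ℤ :=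
  if zero then Finset.Icc (-m) m else (Finset.Icc (-m) m).erase 0

/-- The dimension `n` of the fundamental representation: `2m` or `2m+1`. -/
def nDim (m : ℤ) (zero : Bool) : ℤ := if zero then 2 * m + 1 else 2 * m

/-- `β = n/2 - ε`. -/
def betaC (m : ℤ) (zero : Bool) (sgn : ℂ) : ℂ := (nDim m zero : ℂ) / 2 - sgn

/-- The metric `ε_{ab} = ε_a δ_{a,-b}` with `ε_i = 1` for `i ≥ 0`, `ε_{-i} = ε`. -/
def met (sgn : ℂ) (a b : ℤ) : ℂ :=
  if a = -b then (if 0 ≤ a then 1 else sgn) else 0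

/-- The inverse metric `ε^{ab}`, satisfying `Σ_c ε_{ac} ε^{cb} = δ_a^b`. -/
def metUp (sgn : ℂ) (a b : ℤ) : ℂ :=
  if a = -b then (if 0 ≤ b then 1 else sgn) else 0

/-- The fundamental R-matrix
`R(u)^{a₁a₂}_{b₁b₂} = u(u+β) δ^{a₁}_{b₁} δ^{a₂}_{b₂} + (u+β) δ^{a₁}_{b₂} δ^{a₂}_{b₁}
  - ε u ε^{a₁a₂} ε_{b₁b₂}`. -/
def Rmat (m : ℤ) (zero : Bool) (sgn : ℂ) (u : ℂ) (a1 a2 b1 b2 : ℤ) : ℂ :=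
  u * (u + betaC m zero sgn) * (if a1 = b1 then 1 else 0) * (if a2 = b2 then 1 else 0)
    + (u + betaC m zero sgn) * (if a1 = b2 then 1 else 0) * (if a2 = b1 then 1 else 0)
    - sgn * u * metUp sgn a1 a2 * met sgn b1 b2

/-- The RLL relation for a matrix-valued function `L` with entries in a `ℂ`-algebra `A`. -/
def RLL (m : ℤ) (zero : Bool) (sgn : ℂ) {A : Type*} [Ring A] [Algebra ℂ A]
    (L : ℂ → ℤ → ℤ → A) : Prop :=
  ∀ u v : ℂ, ∀ a1 ∈ Idx m zero, ∀ a2 ∈ Idx m zero, ∀ c1 ∈ Idx m zero, ∀ c2 ∈ Idx m zero,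
    (∑ b1 ∈ Idx m zero, ∑ b2 ∈ Idx m zero,
      Rmat m zero sgn (u - v) a1 a2 b1 b2 • (L u b1 c1 * L v b2 c2))
    = ∑ b1 ∈ Idx m zero, ∑ b2 ∈ Idx m zero,
      Rmat m zero sgn (u - v) b1 b2 c1 c2 • (L v a2 b2 * L u a1 b1)

/-- Lowered-index entries `L_{ab}(u) = Σ_c ε_{ac} L^c_b(u)`. -/
def Llow (m : ℤ) (zero : Bool) (sgn : ℂ) {A : Type*} [Ring A] [Algebra ℂ A]
    (L : ℂ → ℤ → ℤ → A) (u : ℂ) (a b : ℤ) : A :=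
  ∑ c ∈ Idx m zero, met sgn a c • L u c b

/-- Lowered-index entries of a single matrix: `M_{ab} = Σ_c ε_{ac} M^c_b`. -/
def lowMat (m : ℤ) (zero : Bool) (sgn : ℂ) {A : Type*} [Ring A] [Algebra ℂ A]
    (M : ℤ → ℤ → A) (a b : ℤ) : A :=
  ∑ c ∈ Idx m zero, met sgn a c • M c b

/-- The entries of `L(u)` are polynomial in the spectral parameter `u`. -/
def IsPolyFam {A : Type*} [Ring A] [Algebra ℂ A] (L : ℂ → ℤ → ℤ → A) : Prop :=
  ∃ (N : ℕ) (coef : ℕ → ℤ → ℤ → A), ∀ (u : ℂ) (a b : ℤ),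
    L u a b = ∑ k ∈ Finset.range (N + 1), u ^ k • coef k a b

section Fusion

open Matrix

variable {ι : Type*} [Fintype ι] [DecidableEq ι]

/-- The fundamental R-matrix attached to a metric `g` with inverse `h`, over any index type. -/
def metricR (g h : ι → ι → ℂ) (ε β w : ℂ) (a₁ a₂ b₁ b₂ : ι) : ℂ :=
  w * (w + β) * (if a₁ = b₁ then 1 else 0) * (if a₂ = b₂ then 1 else 0)
    + (w + β) * (if a₁ = b₂ then 1 else 0) * (if a₂ = b₁ then 1 else 0)
    - ε * w * h a₁ a₂ * g b₁ b₂

/-- Contraction of the first two tensor factors with the metric. -/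
def contract₁₂ (g : ι → ι → ℂ) : Matrix ι (ι × ι × ι) ℂ :=
  fun a b => g b.1 b.2.1 * if a = b.2.2 then 1 else 0

/-- An operator on two tensor factors acting on factors `1` and `3`. -/
def act₁₃ (R : ι → ι → ι → ι → ℂ) : Matrix (ι × ι × ι) (ι × ι × ι) ℂ :=
  fun a b => R a.1 a.2.2 b.1 b.2.2 * if a.2.1 = b.2.1 then 1 else 0

/-- An operator on two tensor factors acting on factors `2` and `3`. -/
def act₂₃ (R : ι → ι → ι → ι → ℂ) : Matrix (ι × ι × ι) (ι × ι × ι) ℂ :=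
  fun a b => R a.2.1 a.2.2 b.2.1 b.2.2 * if a.1 = b.1 then 1 else 0

variable {A : Type*} [Ring A] [Algebra ℂ A]

/-- A matrix acting on the first tensor factor. -/
def leg₁ (X : Matrix ι ι A) : Matrix (ι × ι × ι) (ι × ι × ι) A :=
  fun a b => if a.2.1 = b.2.1 then if a.2.2 = b.2.2 then X a.1 b.1 else 0 else 0

/-- A matrix acting on the second tensor factor. -/
def leg₂ (X : Matrix ι ι A) : Matrix (ι × ι × ι) (ι × ι × ι) A :=
  fun a b => if a.1 = b.1 then if a.2.2 = b.2.2 then X a.2.1 b.2.1 else 0 else 0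

/-- A matrix acting on the third tensor factor. -/
def leg₃ (X : Matrix ι ι A) : Matrix (ι × ι × ι) (ι × ι × ι) A :=
  fun a b => if a.1 = b.1 then if a.2.1 = b.2.1 then X a.2.2 b.2.2 else 0 else 0

/-- The exchange relation `R L₁ L₂ = L₂ L₁ R` in components. -/
def Exchange (R : ι → ι → ι → ι → ℂ) (X Y : Matrix ι ι A) : Prop :=
  ∀ a₁ a₂ c₁ c₂, ∑ b₁, ∑ b₂, R a₁ a₂ b₁ b₂ • (X b₁ c₁ * Y b₂ c₂)
    = ∑ b₁, ∑ b₂, R b₁ b₂ c₁ c₂ • (Y a₂ b₂ * X a₁ b₁)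

lemma contract₁₂_mul_act₁₃ {g h : ι → ι → ℂ} {ε β : ℂ} (hε : ε * ε = 1)
    (hg : ∀ a b, g a b = ε * g b a) (hgh : ∀ a b, ∑ c, g a c * h c b = if a = b then 1 else 0)
    (w : ℂ) (a b₁ b₂ b₃ : ι) :
    (contract₁₂ g * act₁₃ (metricR g h ε β (w - β))) a (b₁, b₂, b₃)
      = (w - β) * w * g b₁ b₂ * (if a = b₃ then 1 else 0)
        + w * g b₃ b₂ * (if a = b₁ then 1 else 0)
        - (w - β) * g b₁ b₃ * (if b₂ = a then 1 else 0) := by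
  have key : ∑ c, g c b₂ * h c a = ε * if b₂ = a then 1 else 0 := by
    rw [← hgh, Finset.mul_sum]
    exact Finset.sum_congr rfl fun c _ => by rw [hg c b₂]; ring
  have e : ∀ x, g x b₂ * metricR g h ε β (w - β) x a b₁ b₃
      = (w - β) * w * (if a = b₃ then 1 else 0) * (if x = b₁ then g x b₂ else 0)
        + w * (if a = b₁ then 1 else 0) * (if x = b₃ then g x b₂ else 0)
        - ε * (w - β) * g b₁ b₃ * (g x b₂ * h x a) := by
    intro x
    unfold metricR
    split_ifs <;> ring
  have e' : (contract₁₂ g * act₁₃ (metricR g h ε β (w - β))) a (b₁, b₂, b₃)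
      = ∑ x, g x b₂ * metricR g h ε β (w - β) x a b₁ b₃ := by
    simp [Matrix.mul_apply, Fintype.sum_prod_type, contract₁₂, act₁₃]
  rw [e']
  simp only [e, Finset.sum_add_distrib, Finset.sum_sub_distrib, ← Finset.mul_sum, key,
    Finset.sum_ite_eq', Finset.mem_univ, if_true]
  linear_combination (-(w - β) * g b₁ b₃ * (if b₂ = a then 1 else 0)) * hε

lemma contract₁₂_mul_act₁₃_mul_act₂₃ {g h : ι → ι → ℂ} {ε β : ℂ} (hε : ε * ε = 1)
    (hg : ∀ a b, g a b = ε * g b a) (hh : ∀ a b, h a b = ε * h b a)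
    (hgh : ∀ a b, ∑ c, g a c * h c b = if a = b then 1 else 0)
    (hβ : (Fintype.card ι : ℂ) = 2 * (β + ε)) (w : ℂ) :
    contract₁₂ g * act₁₃ (metricR g h ε β (w - β)) * act₂₃ (metricR g h ε β w)
      = ((w - β) * (w + β) * (w ^ 2 - 1)) • contract₁₂ g := by
  ext a ⟨b₁, b₂, c⟩
  have k₁ : ∑ y, g b₁ y * h y a = if b₁ = a then 1 else 0 := hgh _ _
  have k₂ : ∑ z, ∑ y, g z y * h y z = 2 * (β + ε) := by
    simp [hgh, ← hβ]
  have k₃ : ∑ z, g b₁ z * h a z = ε * if b₁ = a then 1 else 0 := by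
    rw [← hgh, Finset.mul_sum]
    exact Finset.sum_congr rfl fun z _ => by rw [hh a z]; ring
  have e' : (contract₁₂ g * act₁₃ (metricR g h ε β (w - β)) * act₂₃ (metricR g h ε β w))
        a (b₁, b₂, c)
      = ∑ z, ∑ y, ((w - β) * w * g b₁ y * (if a = z then 1 else 0)
        + w * g z y * (if a = b₁ then 1 else 0)
        - (w - β) * g b₁ z * (if y = a then 1 else 0)) * metricR g h ε β w y z b₂ c := by
    have e₀ : ∀ x y z, (contract₁₂ g * act₁₃ (metricR g h ε β (w - β))) a (x, y, z)
        * act₂₃ (metricR g h ε β w) (x, y, z) (b₁, b₂, c)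
        = if x = b₁ then ((w - β) * w * g x y * (if a = z then 1 else 0)
          + w * g z y * (if a = x then 1 else 0)
          - (w - β) * g x z * (if y = a then 1 else 0)) * metricR g h ε β w y z b₂ c else 0 := by
      intro x y z
      rw [contract₁₂_mul_act₁₃ hε hg hgh]
      simp [act₂₃]
    rw [Matrix.mul_apply]
    simp only [Fintype.sum_prod_type, e₀]
    rw [Finset.sum_eq_single b₁ (by intro x _ hx; simp [hx]) (by simp), Finset.sum_comm]
    simp only [if_true]
  have e : ∀ z y, ((w - β) * w * g b₁ y * (if a = z then 1 else 0)
        + w * g z y * (if a = b₁ then 1 else 0)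
        - (w - β) * g b₁ z * (if y = a then 1 else 0)) * metricR g h ε β w y z b₂ c
      = (w * (w + β)) * (if z = c then if y = b₂ then
            ((w - β) * w * g b₁ y * (if a = z then 1 else 0)
              + w * g z y * (if a = b₁ then 1 else 0)
              - (w - β) * g b₁ z * (if y = a then 1 else 0)) else 0 else 0)
        + (w + β) * (if z = b₂ then if y = c then
            ((w - β) * w * g b₁ y * (if a = z then 1 else 0)
              + w * g z y * (if a = b₁ then 1 else 0)
              - (w - β) * g b₁ z * (if y = a then 1 else 0)) else 0 else 0)
        - ε * w * g b₂ c * ((w - β) * w * (if a = z then g b₁ y * h y z else 0)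
            + w * (if a = b₁ then 1 else 0) * (g z y * h y z)
            - (w - β) * (if y = a then g b₁ z * h y z else 0)) := by
    intro z y
    have H : metricR g h ε β w y z b₂ c
        = (w * (w + β)) * (if z = c then if y = b₂ then 1 else 0 else 0)
          + (w + β) * (if z = b₂ then if y = c then 1 else 0 else 0)
          - ε * w * h y z * g b₂ c := by
      unfold metricR
      simp only [mul_assoc, ← ite_and, mul_ite, mul_one, mul_zero]
    have d : ∀ (P : Prop) [Decidable P] (x : ℂ),
        (if P then x else 0) = x * if P then 1 else 0 := by
      intro P _ x; split_ifs <;> simp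
    have d' : ∀ (P Q : Prop) [Decidable P] [Decidable Q] (x : ℂ),
        (if P then if Q then x else 0 else 0) = x * if P then if Q then 1 else 0 else 0 := by
      intro P Q _ _ x; split_ifs <;> simp
    obtain ⟨F, hF⟩ : ∃ F, F = (w - β) * w * g b₁ y * (if a = z then 1 else 0)
      + w * g z y * (if a = b₁ then 1 else 0)
      - (w - β) * g b₁ z * (if y = a then 1 else 0) := ⟨_, rfl⟩
    rw [H, ← hF, d' (z = c) (y = b₂) F, d' (z = b₂) (y = c) F, d (a = z) (g b₁ y * h y z),
      d (y = a) (g b₁ z * h y z)]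
    linear_combination (-ε * w * h y z * g b₂ c) * hF
  rw [e']
  simp only [e, Finset.sum_add_distrib, Finset.sum_sub_distrib, ← Finset.mul_sum, k₁, k₂,
    Finset.sum_ite_eq, Finset.sum_ite_eq', Finset.mem_univ, if_true, k₃, Finset.sum_ite_irrel,
    Finset.sum_const_zero]
  simp only [Matrix.smul_apply, contract₁₂, smul_eq_mul, eq_comm (a := b₁) (b := a),
    eq_comm (a := c) (b := a), eq_comm (a := b₂) (b := a), hg c b₂]
  linear_combination (-(w * β + w ^ 2) * g b₂ c * (if a = b₁ then 1 else 0)) * hε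

lemma act₂₃_mul_leg₂_mul_leg₃ {R : ι → ι → ι → ι → ℂ} {Y T : Matrix ι ι A}
    (hR : Exchange R Y T) :
    (act₂₃ R).map (algebraMap ℂ A) * leg₂ Y * leg₃ T
      = leg₃ T * leg₂ Y * (act₂₃ R).map (algebraMap ℂ A) := by
  ext ⟨a₁, a₂, a₃⟩ ⟨c₁, c₂, c₃⟩
  have e₁ : ∀ b₁ b₂ b₃, (leg₂ Y * leg₃ T) (b₁, b₂, b₃) (c₁, c₂, c₃)
      = if b₁ = c₁ then Y b₂ c₂ * T b₃ c₃ else 0 := by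
    intro b₁ b₂ b₃
    simp [Matrix.mul_apply, Fintype.sum_prod_type, leg₂, leg₃]
  have e₂ : ∀ b₁ b₂ b₃, (leg₃ T * leg₂ Y) (a₁, a₂, a₃) (b₁, b₂, b₃)
      = if a₁ = b₁ then T a₃ b₃ * Y a₂ b₂ else 0 := by
    intro b₁ b₂ b₃
    simp [Matrix.mul_apply, Fintype.sum_prod_type, leg₂, leg₃]
  rw [Matrix.mul_assoc, Matrix.mul_apply, Matrix.mul_apply]
  simp only [Fintype.sum_prod_type, e₁, e₂]
  have := hR a₂ a₃ c₂ c₃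
  simp only [Algebra.smul_def, Algebra.commutes] at this
  by_cases h : a₁ = c₁
  · simpa [act₂₃, h, Algebra.commutes] using this
  · simp [act₂₃, h]

lemma act₁₃_mul_leg₁_mul_leg₃ {R : ι → ι → ι → ι → ℂ} {X T : Matrix ι ι A}
    (hR : Exchange R X T) :
    (act₁₃ R).map (algebraMap ℂ A) * leg₁ X * leg₃ T
      = leg₃ T * leg₁ X * (act₁₃ R).map (algebraMap ℂ A) := by
  ext ⟨a₁, a₂, a₃⟩ ⟨c₁, c₂, c₃⟩
  have e₁ : ∀ b₁ b₂ b₃, (leg₁ X * leg₃ T) (b₁, b₂, b₃) (c₁, c₂, c₃)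
      = if b₂ = c₂ then X b₁ c₁ * T b₃ c₃ else 0 := by
    intro b₁ b₂ b₃
    simp [Matrix.mul_apply, Fintype.sum_prod_type, leg₁, leg₃]
  have e₂ : ∀ b₁ b₂ b₃, (leg₃ T * leg₁ X) (a₁, a₂, a₃) (b₁, b₂, b₃)
      = if a₂ = b₂ then T a₃ b₃ * X a₁ b₁ else 0 := by
    intro b₁ b₂ b₃
    simp [Matrix.mul_apply, Fintype.sum_prod_type, leg₁, leg₃]
  rw [Matrix.mul_assoc, Matrix.mul_apply, Matrix.mul_apply]
  simp only [Fintype.sum_prod_type, e₁, e₂]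
  have := hR a₁ a₃ c₁ c₃
  simp only [Algebra.smul_def, Algebra.commutes] at this
  by_cases h : a₂ = c₂
  · simpa [act₁₃, h, Algebra.commutes] using this
  · simp [act₁₃, h]

lemma act₁₃_mul_leg₂ (R : ι → ι → ι → ι → ℂ) (Y : Matrix ι ι A) :
    (act₁₃ R).map (algebraMap ℂ A) * leg₂ Y = leg₂ Y * (act₁₃ R).map (algebraMap ℂ A) := by
  ext ⟨a₁, a₂, a₃⟩ ⟨c₁, c₂, c₃⟩
  simp [Matrix.mul_apply, Fintype.sum_prod_type, leg₂, act₁₃, apply_ite (algebraMap ℂ A),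
    Algebra.commutes]

lemma act₂₃_mul_leg₁ (R : ι → ι → ι → ι → ℂ) (X : Matrix ι ι A) :
    (act₂₃ R).map (algebraMap ℂ A) * leg₁ X = leg₁ X * (act₂₃ R).map (algebraMap ℂ A) := by
  ext ⟨a₁, a₂, a₃⟩ ⟨c₁, c₂, c₃⟩
  simp [Matrix.mul_apply, Fintype.sum_prod_type, leg₁, act₂₃, apply_ite (algebraMap ℂ A),
    Algebra.commutes]

lemma contract₁₂_mul_leg₃ (g : ι → ι → ℂ) (T : Matrix ι ι A) :
    (contract₁₂ g).map (algebraMap ℂ A) * leg₃ T = T * (contract₁₂ g).map (algebraMap ℂ A) := by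
  ext a ⟨c₁, c₂, c₃⟩
  simp [Matrix.mul_apply, Fintype.sum_prod_type, leg₃, contract₁₂, apply_ite (algebraMap ℂ A),
    Algebra.commutes]

lemma contract₁₂_mul_leg₁_mul_leg₂ (g : ι → ι → ℂ) (X Y : Matrix ι ι A) (a c₁ c₂ c₃ : ι) :
    ((contract₁₂ g).map (algebraMap ℂ A) * leg₁ X * leg₂ Y) a (c₁, c₂, c₃)
      = if a = c₃ then ∑ b₁, ∑ b₂, g b₁ b₂ • (X b₁ c₁ * Y b₂ c₂) else 0 := by
  have e : ∀ b₁ b₂ b₃, (leg₁ X * leg₂ Y) (b₁, b₂, b₃) (c₁, c₂, c₃)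
      = if b₃ = c₃ then X b₁ c₁ * Y b₂ c₂ else 0 := by
    intro b₁ b₂ b₃
    simp [Matrix.mul_apply, Fintype.sum_prod_type, leg₁, leg₂]
  rw [Matrix.mul_assoc, Matrix.mul_apply]
  simp only [Fintype.sum_prod_type, e]
  by_cases h : a = c₃ <;> simp [contract₁₂, h, Algebra.smul_def]

/-- A contraction `Σ g_{b₁b₂} X^{b₁}_{c₁} Y^{b₂}_{c₂} = g_{c₁c₂} q` of two matrices that both
satisfy exchange relations with `T` commutes with `T`, up to a scalar factor. -/
theorem smul_commutator_eq_zero {g h : ι → ι → ℂ} {ε β : ℂ} (hε : ε * ε = 1)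
    (hg : ∀ a b, g a b = ε * g b a) (hh : ∀ a b, h a b = ε * h b a)
    (hgh : ∀ a b, ∑ c, g a c * h c b = if a = b then 1 else 0)
    (hβ : (Fintype.card ι : ℂ) = 2 * (β + ε)) {w : ℂ} {X Y T : Matrix ι ι A}
    (hX : Exchange (metricR g h ε β (w - β)) X T) (hY : Exchange (metricR g h ε β w) Y T)
    {q : A} (hq : ∀ c₁ c₂, ∑ b₁, ∑ b₂, g b₁ b₂ • (X b₁ c₁ * Y b₂ c₂) = g c₁ c₂ • q)
    (a b c d : ι) :
    ((w - β) * (w + β) * (w ^ 2 - 1)) • ((g a b • q) * T c d)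
      = ((w - β) * (w + β) * (w ^ 2 - 1)) • (T c d * (g a b • q)) := by
  set f := (w - β) * (w + β) * (w ^ 2 - 1) with hf
  set K : Matrix ι (ι × ι × ι) A := (contract₁₂ g).map (algebraMap ℂ A) with hK
  set R₁ : Matrix (ι × ι × ι) (ι × ι × ι) A :=
    (act₁₃ (metricR g h ε β (w - β))).map (algebraMap ℂ A) with hR₁
  set R₂ : Matrix (ι × ι × ι) (ι × ι × ι) A :=
    (act₂₃ (metricR g h ε β w)).map (algebraMap ℂ A) with hR₂
  have kRR : K * R₁ * R₂ = f • K := by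
    have := congrArg (fun M => M.map (algebraMap ℂ A))
      (contract₁₂_mul_act₁₃_mul_act₂₃ hε hg hh hgh hβ w)
    simp only [Matrix.map_mul] at this
    rw [hK, hR₁, hR₂, this]
    ext i j
    simp [Algebra.smul_def, hf]
  have kXY : K * leg₁ X * leg₂ Y = Matrix.scalar ι q * K := by
    ext i ⟨c₁, c₂, c₃⟩
    rw [hK, contract₁₂_mul_leg₁_mul_leg₂, hq]
    by_cases h : i = c₃ <;> simp [contract₁₂, h, Algebra.smul_def, Algebra.commutes]
  have kX : R₂ * leg₁ X = leg₁ X * R₂ := act₂₃_mul_leg₁ _ X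
  have kY : R₁ * leg₂ Y = leg₂ Y * R₁ := act₁₃_mul_leg₂ _ Y
  have kXT : R₁ * leg₁ X * leg₃ T = leg₃ T * leg₁ X * R₁ := act₁₃_mul_leg₁_mul_leg₃ hX
  have kYT : R₂ * leg₂ Y * leg₃ T = leg₃ T * leg₂ Y * R₂ := act₂₃_mul_leg₂_mul_leg₃ hY
  have kT : K * leg₃ T = T * K := contract₁₂_mul_leg₃ g T
  have main : f • (Matrix.scalar ι q * T * K) = f • (T * Matrix.scalar ι q * K) := by
    calc f • (Matrix.scalar ι q * T * K)
        = f • (K * leg₁ X * leg₂ Y * leg₃ T) := by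
          rw [kXY, Matrix.mul_assoc, Matrix.mul_assoc, kT]
      _ = K * R₁ * (R₂ * leg₁ X) * leg₂ Y * leg₃ T := by
          simp only [← Matrix.mul_assoc, kRR, Matrix.smul_mul]
      _ = K * (R₁ * leg₁ X) * (R₂ * leg₂ Y * leg₃ T) := by
          rw [kX]; simp only [Matrix.mul_assoc]
      _ = K * (R₁ * leg₁ X * leg₃ T) * leg₂ Y * R₂ := by
          rw [kYT]; simp only [Matrix.mul_assoc]
      _ = K * leg₃ T * leg₁ X * (R₁ * leg₂ Y) * R₂ := by
          rw [kXT]; simp only [Matrix.mul_assoc]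
      _ = T * (K * leg₁ X * leg₂ Y) * R₁ * R₂ := by
          rw [kY, kT]; simp only [Matrix.mul_assoc]
      _ = T * Matrix.scalar ι q * (K * R₁ * R₂) := by
          rw [kXY]; simp only [Matrix.mul_assoc]
      _ = f • (T * Matrix.scalar ι q * K) := by
          rw [kRR, Matrix.mul_smul]
  have := congrFun (congrFun main c) (a, b, d)
  have mulK : ∀ M : Matrix ι ι A, (M * K) c (a, b, d) = g a b • M c d := by
    intro M
    simp [Matrix.mul_apply, contract₁₂, hK, apply_ite (algebraMap ℂ A), Algebra.smul_def,
      Algebra.commutes]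
  rw [Matrix.smul_apply, Matrix.smul_apply, mulK, mulK] at this
  simpa [Matrix.diagonal_mul, Matrix.mul_diagonal] using this

/-- Where the R-matrix degenerates to rank one, the exchange relation says that the contraction
of the two matrices with the metric is a multiple of the metric. -/
lemma exists_contraction_eq_smul {g h : ι → ι → ℂ} {ε β : ℂ} (hε : ε * ε = 1) (hβ : β ≠ 0)
    {X Y : Matrix ι ι A} (hXY : Exchange (metricR g h ε β (-β)) X Y)
    {a₁ a₂ : ι} (ha : h a₁ a₂ = ε) :
    ∃ q : A, ∀ c₁ c₂, ∑ b₁, ∑ b₂, g b₁ b₂ • (X b₁ c₁ * Y b₂ c₂) = g c₁ c₂ • q := by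
  refine ⟨ε • ∑ b₁, ∑ b₂, h b₁ b₂ • (Y a₂ b₂ * X a₁ b₁), fun c₁ c₂ => ?_⟩
  have hR : ∀ x y z t, metricR g h ε β (-β) x y z t = β * (ε * h x y * g z t) := by
    intro x y z t
    unfold metricR
    ring
  have := hXY a₁ a₂ c₁ c₂
  simp only [hR, mul_smul, ← Finset.smul_sum] at this
  have := smul_right_injective A hβ this
  simp only [ha] at this
  rw [smul_smul, hε, one_smul] at this
  rw [this]
  simp only [Finset.smul_sum, smul_smul]
  exact Finset.sum_congr rfl fun x _ => Finset.sum_congr rfl fun y _ => by congr 1; ring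

end Fusion

section PolynomialFunctions

open Polynomial

variable {A : Type*} [Ring A] [Algebra ℂ A]

/-- A vector-valued function all of whose scalar components are polynomial. -/
def IsWeaklyPolynomial (g : ℂ → A) : Prop :=
  ∀ φ : A →ₗ[ℂ] ℂ, ∃ p : ℂ[X], ∀ v, φ (g v) = p.eval v

lemma IsWeaklyPolynomial.sub {f g : ℂ → A} (hf : IsWeaklyPolynomial f)
    (hg : IsWeaklyPolynomial g) : IsWeaklyPolynomial fun v => f v - g v := by
  intro φ
  obtain ⟨p, hp⟩ := hf φ
  obtain ⟨q, hq⟩ := hg φ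
  exact ⟨p - q, fun v => by simp [hp, hq]⟩

lemma IsWeaklyPolynomial.eval_smul {g : ℂ → A} (hg : IsWeaklyPolynomial g) (p : ℂ[X]) :
    IsWeaklyPolynomial fun v => p.eval v • g v := by
  intro φ
  obtain ⟨q, hq⟩ := hg φ
  exact ⟨p * q, fun v => by simp [hq]⟩

lemma IsWeaklyPolynomial.const_mul {g : ℂ → A} (hg : IsWeaklyPolynomial g) (x : A) :
    IsWeaklyPolynomial fun v => x * g v :=
  fun φ => hg (φ ∘ₗ LinearMap.mulLeft ℂ x)

lemma IsWeaklyPolynomial.mul_const {g : ℂ → A} (hg : IsWeaklyPolynomial g) (x : A) :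
    IsWeaklyPolynomial fun v => g v * x :=
  fun φ => hg (φ ∘ₗ LinearMap.mulRight ℂ x)

lemma IsPolyFam.isWeaklyPolynomial {L : ℂ → ℤ → ℤ → A} (hL : IsPolyFam L) (a b : ℤ) :
    IsWeaklyPolynomial fun v => L v a b := by
  obtain ⟨N, coef, h⟩ := hL
  intro φ
  refine ⟨∑ k ∈ Finset.range (N + 1), C (φ (coef k a b)) * X ^ k, fun v => ?_⟩
  simp only [h, map_sum, map_smul, smul_eq_mul, eval_finsetSum, eval_mul, eval_C, eval_pow, eval_X,
    mul_comm]

lemma IsWeaklyPolynomial.eq_zero {g : ℂ → A} (hg : IsWeaklyPolynomial g) {s : Set ℂ}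
    (hs : s.Finite) (h : ∀ v ∉ s, g v = 0) (v : ℂ) : g v = 0 := by
  rw [← Module.forall_dual_apply_eq_zero_iff ℂ]
  intro φ
  obtain ⟨p, hp⟩ := hg φ
  have : p = 0 := p.eq_zero_of_infinite_isRoot <| hs.infinite_compl.mono fun x hx => by
    simp [← hp, h x hx]
  simp [hp, this]

end PolynomialFunctions

section Metric

variable {m : ℤ} {zero : Bool} {sgn : ℂ}

lemma mem_Idx {a : ℤ} : a ∈ Idx m zero ↔ (-m ≤ a ∧ a ≤ m) ∧ (zero = false → a ≠ 0) := by
  cases zero <;> simp [Idx, and_comm]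

lemma neg_mem_Idx {a : ℤ} (ha : a ∈ Idx m zero) : -a ∈ Idx m zero := by
  rw [mem_Idx] at *
  refine ⟨by omega, fun h => by have := ha.2 h; omega⟩

lemma card_Idx (hm : 0 ≤ m) : ((Idx m zero).card : ℤ) = nDim m zero := by
  cases zero
  · rw [Idx, if_neg (by simp), Finset.card_erase_of_mem (by simp [hm]), Int.card_Icc, nDim]
    simp only [Bool.false_eq_true, if_false]
    omega
  · simp only [Idx, if_true, Int.card_Icc, nDim]
    omega

lemma met_eq_mul_met_swap (hsgn : sgn = 1 ∨ sgn = -1) (hz : zero = true → sgn = 1) {a b : ℤ}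
    (ha : a ∈ Idx m zero) : met sgn a b = sgn * met sgn b a := by
  unfold met
  by_cases h : a = -b
  · have h' : b = -a := by omega
    simp only [if_pos h, if_pos h']
    have h0 : a = 0 → sgn = 1 := fun h0 => hz (by
      by_contra hzero
      exact (mem_Idx.1 ha).2 (by simpa using hzero) h0)
    split_ifs
    · rw [h0 (by omega)]; simp
    · rcases hsgn with rfl | rfl <;> simp
    · simp
    · omega
  · have h' : ¬b = -a := by omega
    rw [if_neg h, if_neg h', mul_zero]

lemma metUp_eq_met_swap (a b : ℤ) : metUp sgn a b = met sgn b a := by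
  unfold met metUp
  exact if_congr (by omega) rfl rfl

lemma sum_met_smul {M : Type*} [AddCommGroup M] [Module ℂ M] {a : ℤ} (ha : a ∈ Idx m zero)
    (f : ℤ → M) : ∑ c ∈ Idx m zero, met sgn a c • f c = met sgn a (-a) • f (-a) := by
  refine Finset.sum_eq_single_of_mem _ (neg_mem_Idx ha) fun c _ hc => ?_
  rw [met, if_neg (by omega), zero_smul]

lemma met_neg_sq (hsgn : sgn = 1 ∨ sgn = -1) (a : ℤ) : met sgn a (-a) * met sgn a (-a) = 1 := by
  unfold met
  rcases hsgn with rfl | rfl <;> split_ifs <;> simp_all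

lemma sum_met_mul_metUp (hsgn : sgn = 1 ∨ sgn = -1) {a : ℤ} (ha : a ∈ Idx m zero) (b : ℤ) :
    ∑ c ∈ Idx m zero, met sgn a c * metUp sgn c b = if a = b then 1 else 0 := by
  have := sum_met_smul (sgn := sgn) ha fun c => metUp sgn c b
  simp only [smul_eq_mul] at this
  rw [this, metUp_eq_met_swap]
  split_ifs with h
  · rw [← h, met_neg_sq hsgn]
  · rw [met, met, if_neg (c := b = - -a) (by omega), mul_zero]

end Metric

section Contraction

variable {m : ℤ} {zero : Bool} {sgn : ℂ} {A : Type*} [Ring A] [Algebra ℂ A]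
  {L : ℂ → ℤ → ℤ → A}

lemma exchange_of_RLL (hL : RLL m zero sgn L) (u v : ℂ) :
    Exchange (ι := Idx m zero) (metricR (fun a b => met sgn a b) (fun a b => metUp sgn a b) sgn
      (betaC m zero sgn) (u - v)) (fun a b => L u a b) (fun a b => L v a b) := by
  intro a₁ a₂ c₁ c₂
  have := hL u v a₁ a₁.2 a₂ a₂.2 c₁ c₁.2 c₂ c₂.2
  simp only [← Finset.sum_coe_sort (Idx m zero)] at this
  simpa only [Rmat, metricR, Subtype.ext_iff] using this

lemma sum_metUp_smul_Llow_mul_Llow (hsgn : sgn = 1 ∨ sgn = -1) (hz : zero = true → sgn = 1)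
    (u v : ℂ) (a b : ℤ) :
    ∑ x ∈ Idx m zero, ∑ y ∈ Idx m zero,
        metUp sgn x y • (Llow m zero sgn L u x a * Llow m zero sgn L v y b)
      = sgn • ∑ x ∈ Idx m zero, ∑ y ∈ Idx m zero, met sgn x y • (L u x a * L v y b) := by
  rw [Finset.smul_sum]
  refine Finset.sum_nbij' (fun x => -x) (fun x => -x) (fun x hx => neg_mem_Idx hx)
    (fun x hx => neg_mem_Idx hx) (by simp) (by simp) fun x hx => ?_
  have e : ∀ y ∈ Idx m zero, metUp sgn x y • (Llow m zero sgn L u x a * Llow m zero sgn L v y b)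
      = met sgn x y • (sgn • (Llow m zero sgn L u x a * Llow m zero sgn L v y b)) := by
    intro y hy
    rw [metUp_eq_met_swap, met_eq_mul_met_swap hsgn hz hy, smul_smul, mul_comm]
  rw [Finset.sum_congr rfl e, sum_met_smul hx, sum_met_smul (neg_mem_Idx hx), Llow, Llow,
    sum_met_smul hx, sum_met_smul (neg_mem_Idx hx), smul_mul_smul_comm, smul_comm _ sgn,
    smul_smul (met sgn x (-x)), ← mul_assoc, met_neg_sq hsgn, one_mul]

/-- Reduction of the centrality of `C(u)` to that of the contraction with the metric. -/
lemma commute_of_commute_contraction (hsgn : sgn = 1 ∨ sgn = -1) (hz : zero = true → sgn = 1)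
    {u u' v : ℂ} {a b c d : ℤ} (hc : c ∈ Idx m zero)
    (h : Commute (∑ x ∈ Idx m zero, ∑ y ∈ Idx m zero, met sgn x y • (L u x a * L u' y b))
      (L v (-c) d)) :
    Commute (∑ x ∈ Idx m zero, ∑ y ∈ Idx m zero,
        metUp sgn x y • (Llow m zero sgn L u x a * Llow m zero sgn L u' y b))
      (Llow m zero sgn L v c d) := by
  rw [sum_metUp_smul_Llow_mul_Llow hsgn hz, Llow, sum_met_smul hc]
  exact (h.smul_left _).smul_right _

lemma commute_contraction_of_betaC_ne_zero (hm : 1 ≤ m) (hsgn : sgn = 1 ∨ sgn = -1)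
    (hz : zero = true → sgn = 1) (hpoly : IsPolyFam L) (hL : RLL m zero sgn L)
    (hβ : betaC m zero sgn ≠ 0) (u v : ℂ) {a b c d : ℤ} (ha : a ∈ Idx m zero)
    (hb : b ∈ Idx m zero) (hc : c ∈ Idx m zero) (hd : d ∈ Idx m zero) :
    Commute (∑ x ∈ Idx m zero, ∑ y ∈ Idx m zero,
      met sgn x y • (L (u - betaC m zero sgn) x a * L u y b)) (L v c d) := by
  set β := betaC m zero sgn with hβ_def
  have hε : sgn * sgn = 1 := by rcases hsgn with rfl | rfl <;> norm_num
  have hcard : (Fintype.card (Idx m zero) : ℂ) = 2 * (β + sgn) := by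
    have : ((Idx m zero).card : ℂ) = (nDim m zero : ℂ) := by
      exact_mod_cast congrArg (Int.cast (R := ℂ)) (card_Idx (zero := zero) (by omega : 0 ≤ m))
    rw [Fintype.card_coe, this, hβ_def, betaC]
    ring
  have hXY := exchange_of_RLL hL (u - β) u
  rw [show u - β - u = -β by ring] at hXY
  obtain ⟨q, hq⟩ := exists_contraction_eq_smul hε hβ hXY
    (a₁ := ⟨1, mem_Idx.2 ⟨by omega, by simp⟩⟩) (a₂ := ⟨-1, mem_Idx.2 ⟨by omega, by simp⟩⟩)
    (by simp [metUp])
  have hQ : ∑ x ∈ Idx m zero, ∑ y ∈ Idx m zero, met sgn x y • (L (u - β) x a * L u y b)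
      = met sgn a b • q := by
    rw [← hq ⟨a, ha⟩ ⟨b, hb⟩]
    simp only [← Finset.sum_coe_sort (Idx m zero)]
  rw [hQ]
  have hL' := hpoly.isWeaklyPolynomial c d
  refine sub_eq_zero.1 (((hL'.const_mul (met sgn a b • q)).sub
    (hL'.mul_const (met sgn a b • q))).eq_zero
    (s := {u - β, u + β, u - 1, u + 1}) (Set.toFinite _) (fun v hv => ?_) v)
  simp only [Set.mem_insert_iff, Set.mem_singleton_iff, not_or] at hv
  have hf : (u - v - β) * (u - v + β) * ((u - v) ^ 2 - 1) ≠ 0 := by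
    rw [show (u - v) ^ 2 - 1 = (u - v - 1) * (u - v + 1) by ring]
    refine mul_ne_zero (mul_ne_zero ?_ ?_) (mul_ne_zero ?_ ?_)
    · exact fun h => hv.1 (by linear_combination -h)
    · exact fun h => hv.2.1 (by linear_combination -h)
    · exact fun h => hv.2.2.1 (by linear_combination -h)
    · exact fun h => hv.2.2.2 (by linear_combination -h)
  have hX := exchange_of_RLL hL (u - β) v
  rw [sub_right_comm u β v] at hX
  exact sub_eq_zero.2 (smul_right_injective A hf (smul_commutator_eq_zero hε
    (fun x y => met_eq_mul_met_swap hsgn hz x.2)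
    (fun x y => by
      simp only [metUp_eq_met_swap]
      exact met_eq_mul_met_swap hsgn hz y.2)
    (fun x y => by
      rw [Finset.sum_coe_sort (Idx m zero) fun c => met sgn x c * metUp sgn c y,
        sum_met_mul_metUp hsgn x.2]
      simp only [Subtype.ext_iff])
    hcard hX (exchange_of_RLL hL u v) hq ⟨a, ha⟩ ⟨b, hb⟩ ⟨c, hc⟩ ⟨d, hd⟩))

lemma eq_one_of_betaC_eq_zero (hm : 1 ≤ m) (hsgn : sgn = 1 ∨ sgn = -1)
    (hβ : betaC m zero sgn = 0) : m = 1 ∧ zero = false ∧ sgn = 1 := by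
  have h : (nDim m zero : ℂ) = 2 * sgn := by
    rw [betaC] at hβ
    linear_combination 2 * hβ
  rcases hsgn with rfl | rfl
  · have h' : nDim m zero = 2 := by
      rw [mul_one] at h
      exact_mod_cast h
    cases zero <;> simp [nDim] at h' <;> simp <;> omega
  · have h' : nDim m zero = -2 := by
      rw [mul_neg, mul_one] at h
      exact_mod_cast h
    cases zero <;> simp [nDim] at h' <;> omega

lemma Idx_one_false : Idx 1 false = {-1, 1} := by decide

/-- For `so(2)` the R-matrix is diagonal; dividing out its zero at `u = v` is where
polynomiality is needed. -/
lemma RLL.so_two (hpoly : IsPolyFam L) (hL : RLL 1 false 1 L) (u v : ℂ) {a₁ a₂ c₁ c₂ : ℤ}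
    (ha₁ : a₁ ∈ Idx 1 false) (ha₂ : a₂ ∈ Idx 1 false) (hc₁ : c₁ ∈ Idx 1 false)
    (hc₂ : c₂ ∈ Idx 1 false) :
    (u - v + a₁ * a₂) • (L u a₁ c₁ * L v a₂ c₂)
      = (u - v + c₁ * c₂) • (L v a₂ c₂ * L u a₁ c₁) := by
  have key : ∀ v : ℂ, (u - v) • ((u - v + a₁ * a₂) • (L u a₁ c₁ * L v a₂ c₂))
      = (u - v) • ((u - v + c₁ * c₂) • (L v a₂ c₂ * L u a₁ c₁)) := by
    intro v
    have hβ : betaC 1 false 1 = 0 := by simp [betaC, nDim]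
    have := hL u v a₁ ha₁ a₂ ha₂ c₁ hc₁ c₂ hc₂
    rw [Idx_one_false] at *
    simp only [Finset.mem_insert, Finset.mem_singleton] at ha₁ ha₂ hc₁ hc₂
    simp only [Rmat, hβ, met, metUp] at this
    rcases ha₁ with rfl | rfl <;> rcases ha₂ with rfl | rfl <;> rcases hc₁ with rfl | rfl <;>
      rcases hc₂ with rfl | rfl <;> norm_num at this ⊢ <;>
      linear_combination (norm := module) this
  have hL' := hpoly.isWeaklyPolynomial a₂ c₂
  have h := (((hL'.const_mul (L u a₁ c₁)).eval_smul
    (Polynomial.C (u + a₁ * a₂) - Polynomial.X)).sub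
    ((hL'.mul_const (L u a₁ c₁)).eval_smul (Polynomial.C (u + c₁ * c₂) - Polynomial.X))).eq_zero
    (Set.finite_singleton u) (fun v hv => ?_) v
  · simp only [Polynomial.eval_sub, Polynomial.eval_C, Polynomial.eval_X] at h
    rw [sub_add_eq_add_sub, sub_add_eq_add_sub]
    exact sub_eq_zero.1 h
  · have := smul_right_injective A (sub_ne_zero.2 fun h : u = v => hv h.symm) (key v)
    simp only [Polynomial.eval_sub, Polynomial.eval_C, Polynomial.eval_X, sub_eq_zero]
    simpa only [sub_add_eq_add_sub] using this

lemma commute_contraction_so_two (hpoly : IsPolyFam L) (hL : RLL 1 false 1 L) (u v : ℂ)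
    {a b c d : ℤ} (ha : a ∈ Idx 1 false) (hb : b ∈ Idx 1 false) (hc : c ∈ Idx 1 false)
    (hd : d ∈ Idx 1 false) :
    Commute (∑ x ∈ Idx 1 false, ∑ y ∈ Idx 1 false, met 1 x y • (L u x a * L u y b))
      (L v c d) := by
  have hsq : ∀ {x : ℤ}, x ∈ Idx 1 false → (x : ℂ) ^ 2 = 1 := by
    intro x hx
    rw [Idx_one_false] at hx
    simp only [Finset.mem_insert, Finset.mem_singleton] at hx
    rcases hx with rfl | rfl <;> norm_num
  have hQ : ∑ x ∈ Idx 1 false, ∑ y ∈ Idx 1 false, met 1 x y • (L u x a * L u y b)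
      = L u (-1) a * L u 1 b + L u 1 a * L u (-1) b := by
    rw [Idx_one_false]
    norm_num [met]
  have h1 : (1 : ℤ) ∈ Idx 1 false := by decide
  have h1' : (-1 : ℤ) ∈ Idx 1 false := by decide
  rw [hQ]
  by_cases hab : a = b
  · subst hab
    have := hL.so_two hpoly u u h1 h1' ha ha
    have hs := hsq ha
    rw [sub_self, zero_add, zero_add, ← pow_two (a : ℂ), hs, one_smul] at this
    rw [← this]
    simp
  · have hb' : b = -a := by
      rw [Idx_one_false] at ha hb
      simp only [Finset.mem_insert, Finset.mem_singleton] at ha hb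
      omega
    subst hb'
    have key : ∀ e ∈ Idx 1 false, Commute (L u e a * L u (-e) (-a)) (L v c d) := by
      intro e he
      have hL' := hpoly.isWeaklyPolynomial c d
      refine sub_eq_zero.1 (((hL'.const_mul _).sub (hL'.mul_const _)).eq_zero
        (s := {u - 1, u + 1}) (Set.toFinite _) (fun v hv => ?_) v)
      simp only [Set.mem_insert_iff, Set.mem_singleton_iff, not_or] at hv
      have hf : (u - v - 1) * (u - v + 1) ≠ 0 := by
        refine mul_ne_zero ?_ ?_
        · exact fun h => hv.1 (by linear_combination -h)
        · exact fun h => hv.2 (by linear_combination -h)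
      have h₁ := hL.so_two hpoly u v he hc ha hd
      have h₂ := hL.so_two hpoly u v (neg_mem_Idx he) hc (neg_mem_Idx ha) hd
      push_cast at h₂
      refine sub_eq_zero.2 (smul_right_injective A hf ?_)
      have e₁ : (u - v - 1) * (u - v + 1) = (u - v + e * c) * (u - v + -e * c) := by
        linear_combination (e : ℂ) ^ 2 * hsq hc + hsq he
      have e₂ : (u - v - 1) * (u - v + 1) = (u - v + -a * d) * (u - v + a * d) := by
        linear_combination (a : ℂ) ^ 2 * hsq hd + hsq ha
      calc ((u - v - 1) * (u - v + 1)) • (L u e a * L u (-e) (-a) * L v c d)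
          = (u - v + e * c) • (L u e a * ((u - v + -e * c) • (L u (-e) (-a) * L v c d))) := by
            rw [e₁, mul_smul, mul_smul_comm, mul_assoc]
        _ = (u - v + -a * d) • (((u - v + e * c) • (L u e a * L v c d)) * L u (-e) (-a)) := by
            rw [h₂, mul_smul_comm, smul_mul_assoc, smul_comm, mul_assoc]
        _ = ((u - v - 1) * (u - v + 1)) • (L v c d * (L u e a * L u (-e) (-a))) := by
            rw [h₁, e₂, mul_smul, smul_mul_assoc, mul_assoc]
    have k := key (-1) h1'
    rw [neg_neg] at k
    exact k.add_left (key 1 h1)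

end Contraction

/-- the entries of `C(u)` are central with respect to `L`. -/
theorem stmt1 (m : ℤ) (zero : Bool) (sgn : ℂ) (hm : 1 ≤ m)
    (hsgn : sgn = 1 ∨ sgn = -1) (hz : zero = true → sgn = 1)
    (A : Type*) [Ring A] [Algebra ℂ A]
    (L : ℂ → ℤ → ℤ → A) (hpoly : IsPolyFam L)
    (hRLL : RLL m zero sgn L) :
    ∀ u v : ℂ, ∀ a ∈ Idx m zero, ∀ b ∈ Idx m zero, ∀ c ∈ Idx m zero, ∀ d ∈ Idx m zero,
      (∑ x ∈ Idx m zero, ∑ y ∈ Idx m zero,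
        metUp sgn x y •
          (Llow m zero sgn L (u - betaC m zero sgn) x a * Llow m zero sgn L u y b))
          * Llow m zero sgn L v c d
        = Llow m zero sgn L v c d *
          (∑ x ∈ Idx m zero, ∑ y ∈ Idx m zero,
            metUp sgn x y •
              (Llow m zero sgn L (u - betaC m zero sgn) x a * Llow m zero sgn L u y b)) := by
  intro u v a ha b hb c hc d hd
  refine commute_of_commute_contraction hsgn hz hc ?_
  by_cases hβ : betaC m zero sgn = 0
  · obtain ⟨rfl, rfl, rfl⟩ := eq_one_of_betaC_eq_zero hm hsgn hβ
    rw [hβ, sub_zero]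
    exact commute_contraction_so_two hpoly hRLL u v ha hb (neg_mem_Idx hc) hd
  · exact commute_contraction_of_betaC_ne_zero hm hsgn hz hpoly hRLL hβ u v ha hb
      (neg_mem_Idx hc) hd
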